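/- Let P be a finite poset that has the non-messing-up property via the pair of chain covers {C₁, C₂}. Let Q be a diamond in P consisting of saturated chains a and b with minimum x and maximum y, equipped with a bottom chain C (a saturated chain of k elements whose maximum is covered by x) and a top chain D (a saturated chain of l elements whose minimum covers y), such that Q ∪ C ∪ D is a convex subposet of P with no elements or order relations other than those just described. Suppose Q has Type I with respect to {C₁, C₂}. Then, possibly after swapping C₁ and C₂: some chain of C₁ contains (C ∪ a)∖{y}, some chain of C₂ contains (C ∪ b)∖{y}, some chain of C₂ contains (a ∪ D)∖{x}, and some chain of C₁ contains (b ∪ D)∖{x}; moreover max{|C|, |D|} < min{|a| − 2, |b| − 2}. -/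

import Mathlib

/-- A saturated chain in a poset: a chain such that any two consecutive elements of the
chain form a covering relation of the ambient poset. -/
def IsSatChain (P : Type*) [PartialOrder P] (c : Set P) : Prop :=
  IsChain (· ≤ ·) c ∧
    ∀ x ∈ c, ∀ y ∈ c, x < y → (∀ z ∈ c, ¬(x < z ∧ z < y)) → x ⋖ y

/-- A chain cover of a poset: a set of pairwise disjoint saturated chains whose
union is the whole poset. -/
def IsChainCover (P : Type*) [PartialOrder P] (C : Set (Set P)) : Prop :=
  (∀ c ∈ C, IsSatChain P c) ∧ C.PairwiseDisjoint id ∧ ∀ x : P, ∃ c ∈ C, x ∈ c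

/-- `mu` is the `C`-sort of the labeling `lam`: on each chain of `C`, `mu` rearranges the
multiset of `lam`-labels of that chain so that they are weakly increasing along the chain. -/
def IsCSort (P : Type*) [PartialOrder P] (C : Set (Set P)) (lam mu : P → ℝ) : Prop :=
  ∃ σ : Equiv.Perm P, (∀ c ∈ C, ∀ x ∈ c, σ x ∈ c) ∧ (∀ x, mu x = lam (σ x)) ∧
    ∀ c ∈ C, ∀ x ∈ c, ∀ y ∈ c, x ≤ y → mu x ≤ mu y

/-- The labeling `nu` is weakly increasing along every chain of `C`. -/
def SortedAlong (P : Type*) [PartialOrder P] (C : Set (Set P)) (nu : P → ℝ) : Prop :=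
  ∀ c ∈ C, ∀ x ∈ c, ∀ y ∈ c, x ≤ y → nu x ≤ nu y

/-- `P` has the non-messing-up property via the (unordered) pair of chain covers
`{C₁, C₂}`: for any labeling, sorting along one cover and then along the other leaves the
labels sorted along the chains of the first cover, and moreover every covering relation of
`P` lies in some chain of `C₁` or of `C₂`. -/
def NMUvia (P : Type*) [PartialOrder P] (C₁ C₂ : Set (Set P)) : Prop :=
  IsChainCover P C₁ ∧ IsChainCover P C₂ ∧
  (∀ lam mu nu : P → ℝ, IsCSort P C₁ lam mu → IsCSort P C₂ mu nu → SortedAlong P C₁ nu) ∧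
  (∀ lam mu nu : P → ℝ, IsCSort P C₂ lam mu → IsCSort P C₁ mu nu → SortedAlong P C₂ nu) ∧
  ∀ x y : P, x ⋖ y → ∃ c, (c ∈ C₁ ∨ c ∈ C₂) ∧ x ∈ c ∧ y ∈ c

/-- The class `N₂`: posets having the non-messing-up property via some pair of chain
covers. -/
def InN2 (P : Type*) [PartialOrder P] : Prop := ∃ C₁ C₂, NMUvia P C₁ C₂

/-- A diamond in a poset: two distinct saturated chains `a` and `b` which intersect exactly
in a common minimal element `x` and a common maximal element `y`, whose union is convex. -/
def IsDiamond (P : Type*) [PartialOrder P] (a b : Set P) (x y : P) : Prop :=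
  IsSatChain P a ∧ IsSatChain P b ∧ a ≠ b ∧ a ∩ b = {x, y} ∧
    (∀ z ∈ a ∪ b, x ≤ z ∧ z ≤ y) ∧ (a ∪ b).OrdConnected

/-- The diamond on chains `a`, `b` with minimum `x` and maximum `y` has Type I with respect
to the ordered pair of chain covers `(C₁, C₂)`. -/
def TypeI (P : Type*) [PartialOrder P] (C₁ C₂ : Set (Set P)) (a b : Set P) (x y : P) : Prop :=
  (∃ c ∈ C₁, a \ {y} ⊆ c) ∧ (∃ c ∈ C₂, b \ {y} ⊆ c) ∧
  (∃ c ∈ C₁, b \ {x} ⊆ c) ∧ (∃ c ∈ C₂, a \ {x} ⊆ c)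


theorem IsSatChain.dual {P : Type*} [PartialOrder P] {s : Set P} (hs : IsSatChain P s) :
    IsSatChain Pᵒᵈ s :=
  ⟨hs.1.symm, fun x hx y hy hxy hz =>
    (hs.2 y hy x hx hxy fun z hzs hzz => hz z hzs ⟨hzz.2, hzz.1⟩).toDual⟩

theorem IsChainCover.dual {P : Type*} [PartialOrder P] {C : Set (Set P)}
    (hC : IsChainCover P C) : IsChainCover Pᵒᵈ C :=
  ⟨fun c hc => (hC.1 c hc).dual, hC.2.1, hC.2.2⟩

/-- Negating the labels turns a sort in the dual order into a sort in the original order. -/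
theorem IsCSort.of_dual {P : Type*} [PartialOrder P] {C : Set (Set P)} {lam mu : P → ℝ}
    (hs : IsCSort Pᵒᵈ C lam mu) : IsCSort P C (fun z => -lam z) (fun z => -mu z) := by
  obtain ⟨σ, h₁, h₂, h₃⟩ := hs
  exact ⟨σ, h₁, fun z => congrArg Neg.neg (h₂ z),
    fun c hc u hu v hv huv => neg_le_neg (h₃ c hc v hv u hu huv)⟩

theorem NMUvia.symm {P : Type*} [PartialOrder P] {C₁ C₂ : Set (Set P)}
    (h : NMUvia P C₁ C₂) : NMUvia P C₂ C₁ := by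
  refine ⟨h.2.1, h.1, h.2.2.2.1, h.2.2.1, fun u v huv => ?_⟩
  obtain ⟨c, hc, hu⟩ := h.2.2.2.2 u v huv
  exact ⟨c, hc.symm, hu⟩

theorem NMUvia.dual {P : Type*} [PartialOrder P] {C₁ C₂ : Set (Set P)}
    (h : NMUvia P C₁ C₂) : NMUvia Pᵒᵈ C₁ C₂ := by
  refine ⟨h.1.dual, h.2.1.dual, fun lam mu nu h₁ h₂ c hc u hu v hv huv => ?_,
    fun lam mu nu h₁ h₂ c hc u hu v hv huv => ?_, fun u v huv => ?_⟩
  · exact neg_le_neg_iff.1 (h.2.2.1 _ _ _ h₁.of_dual h₂.of_dual c hc v hv u hu huv)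
  · exact neg_le_neg_iff.1 (h.2.2.2.1 _ _ _ h₁.of_dual h₂.of_dual c hc v hv u hu huv)
  · obtain ⟨c, hc, hu, hv⟩ := h.2.2.2.2 v u huv.ofDual
    exact ⟨c, hc, hv, hu⟩

theorem IsDiamond.symm {P : Type*} [PartialOrder P] {a b : Set P} {x y : P}
    (hd : IsDiamond P a b x y) : IsDiamond P b a x y := by
  obtain ⟨ha, hb, hne, hab, hz, hc⟩ := hd
  exact ⟨hb, ha, hne.symm, Set.inter_comm a b ▸ hab, Set.union_comm a b ▸ hz,
    Set.union_comm a b ▸ hc⟩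

theorem IsDiamond.dual {P : Type*} [PartialOrder P] {a b : Set P} {x y : P}
    (hd : IsDiamond P a b x y) : IsDiamond Pᵒᵈ a b y x := by
  obtain ⟨ha, hb, hne, hab, hz, hc⟩ := hd
  exact ⟨ha.dual, hb.dual, hne, hab.trans (Set.pair_comm x y), fun z h => (hz z h).symm,
    ⟨fun u hu v hv w hw => hc.out hv hu ⟨hw.2, hw.1⟩⟩⟩

theorem TypeI.symm {P : Type*} [PartialOrder P] {C₁ C₂ : Set (Set P)} {a b : Set P} {x y : P}
    (h : TypeI P C₁ C₂ a b x y) : TypeI P C₂ C₁ b a x y :=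
  ⟨h.2.1, h.1, h.2.2.2, h.2.2.1⟩

theorem TypeI.dual {P : Type*} [PartialOrder P] {C₁ C₂ : Set (Set P)} {a b : Set P} {x y : P}
    (h : TypeI P C₁ C₂ a b x y) : TypeI Pᵒᵈ C₁ C₂ b a y x :=
  ⟨h.2.2.1, h.2.2.2, h.1, h.2.1⟩

theorem IsChainCover.eq_of_mem {P : Type*} [PartialOrder P] {C : Set (Set P)}
    (hC : IsChainCover P C) {c d : Set P} (hc : c ∈ C) (hd : d ∈ C) {z : P}
    (hzc : z ∈ c) (hzd : z ∈ d) : c = d :=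
  hC.2.1.elim_set hc hd z hzc hzd

/-- A saturated chain contains every element of its range that is comparable to all nearby
elements of the chain. -/
theorem IsSatChain.mem_of_comparable {P : Type*} [PartialOrder P] [Finite P] {s : Set P}
    (hs : IsSatChain P s) {u v z : P} (hu : u ∈ s) (hv : v ∈ s) (huz : u ≤ z) (hzv : z ≤ v)
    (hcomp : ∀ w ∈ s, u ≤ w → w ≤ v → w ≤ z ∨ z ≤ w) : z ∈ s := by
  by_contra hz
  have hlt₁ : u < z := lt_of_le_of_ne huz fun h => hz (h ▸ hu)
  have hlt₂ : z < v := lt_of_le_of_ne hzv fun h => hz (h ▸ hv)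
  obtain ⟨p, hp⟩ := (Set.toFinite {w | w ∈ s ∧ u ≤ w ∧ w < z}).exists_maximal
    ⟨u, hu, le_rfl, hlt₁⟩
  obtain ⟨q, hq⟩ := (Set.toFinite {w | w ∈ s ∧ z < w ∧ w ≤ v}).exists_minimal
    ⟨v, hv, hlt₂, le_rfl⟩
  obtain ⟨⟨hps, hup, hpz⟩, hpmax⟩ := hp
  obtain ⟨⟨hqs, hzq, hqv⟩, hqmin⟩ := hq
  refine (hs.2 p hps q hqs (hpz.trans hzq) fun w hw hpw => ?_).2 hpz hzq
  rcases hcomp w hw (hup.trans hpw.1.le) (hpw.2.le.trans hqv) with hwz | hzw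
  · have : w < z := lt_of_le_of_ne hwz fun h => hz (h ▸ hw)
    exact (hpw.1.trans_le (hpmax ⟨hw, hup.trans hpw.1.le, this⟩ hpw.1.le)).false
  · have : z < w := lt_of_le_of_ne hzw fun h => hz (h ▸ hw)
    exact ((hqmin ⟨hw, this, hpw.2.le.trans hqv⟩ hpw.2.le).trans_lt hpw.2).false

/-- Every labeling of a finite poset has a sort along any chain cover. -/
theorem IsChainCover.exists_isCSort {P : Type*} [PartialOrder P] [Finite P] {C : Set (Set P)}
    (hC : IsChainCover P C) (lam : P → ℝ) : ∃ mu, IsCSort P C lam mu := by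
  classical
  have := Fintype.ofFinite P
  let f : P → ℝ := fun z => (Set.Iic z).ncard
  have hf : ∀ u v, u < v → f u < f v := fun u v huv => by
    exact Nat.cast_lt.2 (Set.ncard_lt_ncard (Set.Iic_ssubset_Iic.2 huv))
  obtain ⟨σ, hσ, hmax⟩ := Set.exists_max_image
    {σ : Equiv.Perm P | ∀ c ∈ C, ∀ z ∈ c, σ z ∈ c} (fun σ => ∑ z, lam (σ z) * f z)
    (Set.toFinite _) ⟨1, fun _ _ _ hz => hz⟩
  refine ⟨fun z => lam (σ z), σ, hσ, fun _ => rfl, fun c hc u hu v hv huv => ?_⟩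
  by_contra! hlt
  have hne : u ≠ v := by rintro rfl; exact hlt.false
  have huv' := hf u v (lt_of_le_of_ne huv hne)
  have hle := hmax (Equiv.swap u v |>.trans σ) fun d hd z hz => by
    refine hσ d hd _ ?_
    by_cases hzu : z = u
    · subst hzu
      rw [Equiv.swap_apply_left, hC.eq_of_mem hd hc hz hu]; exact hv
    · by_cases hzv : z = v
      · subst hzv
        rw [Equiv.swap_apply_right, hC.eq_of_mem hd hc hz hv]; exact hu
      · rwa [Equiv.swap_apply_of_ne_of_ne hzu hzv]
  have hsum : ∑ z, lam (σ (Equiv.swap u v z)) * f z - ∑ z, lam (σ z) * f z =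
      (lam (σ v) - lam (σ u)) * (f u - f v) := by
    rw [← Finset.sum_sub_distrib, ← Finset.sum_subset (Finset.subset_univ {u, v}),
      Finset.sum_pair hne, Equiv.swap_apply_left, Equiv.swap_apply_right]
    · ring
    · intro z _ hz
      simp only [Finset.mem_insert, Finset.mem_singleton, not_or] at hz
      rw [Equiv.swap_apply_of_ne_of_ne hz.1 hz.2, sub_self]
  simp only [Equiv.trans_apply] at hle
  nlinarith

theorem ncard_preimage_perm {P : Type*} [Finite P] {σ : Equiv.Perm P} {c : Set P}
    (hσ : ∀ z ∈ c, σ z ∈ c) (S : Set P) : {z | z ∈ c ∧ σ z ∈ S}.ncard = (c ∩ S).ncard := by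
  have him : σ '' c = c := Set.eq_of_subset_of_ncard_le (Set.image_subset_iff.2 hσ)
    (Set.ncard_image_of_injective c σ.injective).ge
  rw [← Set.ncard_image_of_injective _ σ.injective]
  congr 1
  ext z
  constructor
  · rintro ⟨w, ⟨hw, hwS⟩, rfl⟩
    exact ⟨hσ w hw, hwS⟩
  · rintro ⟨hz, hzS⟩
    obtain ⟨w, hw, rfl⟩ := him ▸ hz
    exact ⟨w, ⟨hw, hzS⟩, rfl⟩

/-- The zero-one obstruction: start with the indicator of a set `S` that is an upper set on the
chains of `C₂`, and sort along `C₁`. If `S` meets the `C₁`-chain `A` of `u` often enough that `u`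
gets the label one, then it meets the `C₁`-chain `B` of `v` often enough that `v` does too. -/
theorem NMUvia.ncard_le_of_ncard_le {P : Type*} [PartialOrder P] [Finite P]
    {C₁ C₂ : Set (Set P)} (h : NMUvia P C₁ C₂) {S : Set P}
    (hS : ∀ c ∈ C₂, ∀ u ∈ c, ∀ v ∈ c, u ≤ v → u ∈ S → v ∈ S)
    {A B c : Set P} (hA : A ∈ C₁) (hB : B ∈ C₁) (hc : c ∈ C₂) {u v : P} (huc : u ∈ c)
    (hvc : v ∈ c) (huv : u ≤ v) (huA : u ∈ A) (hvB : v ∈ B)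
    (hu : {z | z ∈ A ∧ u ≤ z}.ncard ≤ (A ∩ S).ncard) :
    {z | z ∈ B ∧ v ≤ z}.ncard ≤ (B ∩ S).ncard := by
  classical
  let lam : P → ℝ := S.indicator 1
  have hpos : ∀ z, 0 < lam z ↔ z ∈ S := fun z => by
    by_cases hz : z ∈ S <;> simp [lam, hz]
  have hlam : IsCSort P C₂ lam lam := by
    refine ⟨1, fun _ _ _ hz => hz, fun _ => rfl, fun d hd p hp q hq hpq => ?_⟩
    by_cases hpS : p ∈ S
    · simp [lam, hpS, hS d hd p hp q hq hpq hpS]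
    · rw [show lam p = 0 by simp [lam, hpS]]
      exact Set.indicator_nonneg (fun _ _ => zero_le_one) q
  obtain ⟨nu, hnu⟩ := h.1.exists_isCSort lam
  have hmono := h.2.2.2.1 _ _ _ hlam hnu c hc u huc v hvc huv
  obtain ⟨σ, hσ, hval, hsort⟩ := hnu
  have hnupos : ∀ z, 0 < nu z ↔ σ z ∈ S := fun z => hval z ▸ hpos (σ z)
  have hupos : 0 < nu u := by
    by_contra hneg
    rw [← ncard_preimage_perm (hσ A hA)] at hu
    refine hu.not_gt (Set.ncard_lt_ncard ⟨fun z hz => ⟨hz.1, ?_⟩, fun hsub => ?_⟩)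
    · by_contra huz
      refine hneg (((hnupos z).2 hz.2).trans_le (hsort A hA z hz.1 u huA ?_))
      exact ((h.1.1 A hA).1.total huA hz.1).resolve_left huz
    · exact hneg ((hnupos u).2 (hsub ⟨huA, le_rfl⟩).2)
  rw [← ncard_preimage_perm (hσ B hB)]
  refine Set.ncard_le_ncard fun z hz => ⟨hz.1, (hnupos z).1 ?_⟩
  exact (hupos.trans_le hmono).trans_le (hsort B hB v hvB z hz.1 hz.2)

theorem IsDiamond.lt {P : Type*} [PartialOrder P] {a b : Set P} {x y : P}
    (hd : IsDiamond P a b x y) : x < y := by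
  obtain ⟨-, -, hne, hab, hz, -⟩ := hd
  have hx : x ∈ a ∩ b := hab ▸ Set.mem_insert x {y}
  refine lt_of_le_of_ne (hz x (Or.inl hx.1)).2 fun hxy => hne ?_
  have heq : ∀ z ∈ a ∪ b, z = x := fun z h => le_antisymm (hxy ▸ (hz z h).2) (hz z h).1
  ext z
  exact ⟨fun h => heq z (Or.inl h) ▸ hx.2, fun h => heq z (Or.inr h) ▸ hx.1⟩

/-- The first chain of a diamond has an inner element covering the minimum. -/
theorem IsDiamond.exists_atom {P : Type*} [PartialOrder P] [Finite P] {a b : Set P} {x y : P}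
    (hd : IsDiamond P a b x y) :
    ∃ a₁ ∈ a, a₁ ≠ x ∧ a₁ ≠ y ∧ x ⋖ a₁ ∧ ∀ z ∈ a, z < a₁ → z = x := by
  have hxy := hd.lt
  obtain ⟨ha, -, hne, hab, hz, -⟩ := hd
  have hx : x ∈ a ∩ b := hab ▸ Set.mem_insert x {y}
  have hy : y ∈ a ∩ b := hab ▸ Set.mem_insert_of_mem x rfl
  obtain ⟨p, ⟨hpa, hpx⟩, hpmin⟩ := (Set.toFinite (a \ {x})).exists_minimal ⟨y, hy.1, hxy.ne'⟩
  have hmin : ∀ z ∈ a, z < p → z = x := fun z hza hzp => by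
    by_contra hzx
    exact ((hpmin ⟨hza, hzx⟩ hzp.le).trans_lt hzp).false
  have hxp : x < p := lt_of_le_of_ne (hz p (Or.inl hpa)).1 (Ne.symm hpx)
  have hcov : x ⋖ p := ha.2 x hx.1 p hpa hxp fun z hza hzz => hzz.1.ne' (hmin z hza hzz.2)
  refine ⟨p, hpa, hpx, fun hpy => hne ?_, hcov, hmin⟩
  have heq : ∀ z ∈ a ∪ b, z = x ∨ z = y := fun z h =>
    hpy ▸ hcov.eq_or_eq (hz z h).1 (hpy ▸ (hz z h).2)
  ext z
  constructor
  · intro h; rcases heq z (Or.inl h) with rfl | rfl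
    exacts [hx.2, hy.2]
  · intro h; rcases heq z (Or.inr h) with rfl | rfl
    exacts [hx.1, hy.1]

/-- A Type I diamond with chosen covering chains and atoms, above a set `D` of elements such
that the intervals from `D` to the maximum of the diamond contain nothing unexpected. -/
structure DiamondAbove (P : Type*) [PartialOrder P] (C₁ C₂ : Set (Set P))
    (a b D A₁ B₁ A₂ B₂ : Set P) (x y a₁ b₁ : P) : Prop where
  nmu : NMUvia P C₁ C₂
  diamond : IsDiamond P a b x y
  hA₁ : A₁ ∈ C₁
  hB₁ : B₁ ∈ C₁
  hA₂ : A₂ ∈ C₂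
  hB₂ : B₂ ∈ C₂
  aA₁ : a \ {y} ⊆ A₁
  bB₁ : b \ {x} ⊆ B₁
  aA₂ : a \ {x} ⊆ A₂
  bB₂ : b \ {y} ⊆ B₂
  ha₁ : a₁ ∈ a ∧ a₁ ≠ x ∧ a₁ ≠ y ∧ x ⋖ a₁ ∧ ∀ z ∈ a, z < a₁ → z = x
  hb₁ : b₁ ∈ b ∧ b₁ ≠ x ∧ b₁ ≠ y ∧ x ⋖ b₁ ∧ ∀ z ∈ b, z < b₁ → z = x
  incomp : ¬a₁ ≤ b₁ ∧ ¬b₁ ≤ a₁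
  below : ∀ d ∈ D, d < x
  interval : ∀ d ∈ D, ∀ z, d ≤ z → z ≤ y → z ∈ a ∪ b ∪ D

namespace DiamondAbove

variable {P : Type*} [PartialOrder P] {C₁ C₂ : Set (Set P)}
  {a b D A₁ B₁ A₂ B₂ : Set P} {x y a₁ b₁ : P}

theorem symm (h : DiamondAbove P C₁ C₂ a b D A₁ B₁ A₂ B₂ x y a₁ b₁) :
    DiamondAbove P C₂ C₁ b a D B₂ A₂ B₁ A₁ x y b₁ a₁ where
  nmu := h.nmu.symm
  diamond := h.diamond.symm
  hA₁ := h.hB₂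
  hB₁ := h.hA₂
  hA₂ := h.hB₁
  hB₂ := h.hA₁
  aA₁ := h.bB₂
  bB₁ := h.aA₂
  aA₂ := h.bB₁
  bB₂ := h.aA₁
  ha₁ := h.hb₁
  hb₁ := h.ha₁
  incomp := h.incomp.symm
  below := h.below
  interval := Set.union_comm a b ▸ h.interval

theorem mem_inter (h : DiamondAbove P C₁ C₂ a b D A₁ B₁ A₂ B₂ x y a₁ b₁) :
    x ∈ a ∩ b ∧ y ∈ a ∩ b := by
  rw [h.diamond.2.2.2.1]
  simp

theorem x_mem (h : DiamondAbove P C₁ C₂ a b D A₁ B₁ A₂ B₂ x y a₁ b₁) : x ∈ A₁ :=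
  h.aA₁ ⟨h.mem_inter.1.1, h.diamond.lt.ne⟩

theorem y_mem (h : DiamondAbove P C₁ C₂ a b D A₁ B₁ A₂ B₂ x y a₁ b₁) : y ∈ B₁ :=
  h.bB₁ ⟨h.mem_inter.2.2, h.diamond.lt.ne'⟩

theorem b₁_mem (h : DiamondAbove P C₁ C₂ a b D A₁ B₁ A₂ B₂ x y a₁ b₁) : b₁ ∈ B₁ :=
  h.bB₁ ⟨h.hb₁.1, h.hb₁.2.1⟩

theorem b₁_lt (h : DiamondAbove P C₁ C₂ a b D A₁ B₁ A₂ B₂ x y a₁ b₁) : b₁ < y :=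
  lt_of_le_of_ne (h.diamond.2.2.2.2.1 b₁ (Or.inr h.hb₁.1)).2 h.hb₁.2.2.1

theorem notMem (h : DiamondAbove P C₁ C₂ a b D A₁ B₁ A₂ B₂ x y a₁ b₁) {z : P}
    (hz : z ∈ A₁) : z ∉ B₁ := by
  intro hz'
  have ha₁ : a₁ ∈ A₁ := h.aA₁ ⟨h.ha₁.1, h.ha₁.2.2.1⟩
  rw [h.nmu.1.eq_of_mem h.hA₁ h.hB₁ hz hz'] at ha₁
  exact ((h.nmu.1.1 B₁ h.hB₁).1.total ha₁ h.b₁_mem).elim h.incomp.1 h.incomp.2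

theorem notMem_of_le (h : DiamondAbove P C₁ C₂ a b D A₁ B₁ A₂ B₂ x y a₁ b₁) {z : P}
    (hz : z ∈ a ∪ b) (hzb : z < b₁) : z ∉ B₁ := by
  rcases hz with hz | hz
  · exact h.notMem (h.aA₁ ⟨hz, (hzb.trans h.b₁_lt).ne⟩)
  · exact h.hb₁.2.2.2.2 z hz hzb ▸ h.notMem h.x_mem

theorem notMem_of_mem (h : DiamondAbove P C₁ C₂ a b D A₁ B₁ A₂ B₂ x y a₁ b₁) [Finite P]
    {d : P} (hd : d ∈ D) : d ∉ B₁ := by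
  intro hdB
  refine h.notMem h.x_mem ((h.nmu.1.1 B₁ h.hB₁).mem_of_comparable hdB h.b₁_mem
    (h.below d hd).le h.hb₁.2.2.2.1.le fun w _ hdw hwb => ?_)
  rcases h.interval d hd w hdw (hwb.trans h.b₁_lt.le) with hw | hw
  · exact Or.inr (h.diamond.2.2.2.2.1 w hw).1
  · exact Or.inl (h.below w hw).le

/-- An element of `D` on the `C₁`-chain of the minimum is also on its `C₂`-chain. -/
theorem mem_of_mem (h : DiamondAbove P C₁ C₂ a b D A₁ B₁ A₂ B₂ x y a₁ b₁) [Finite P]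
    {d : P} (hd : d ∈ D) (hdA : d ∈ A₁) : d ∈ B₂ := by
  by_contra hdB
  obtain ⟨M, hM, hdM⟩ := h.nmu.2.1.2.2 d
  have hbB₂ : b₁ ∈ B₂ := h.bB₂ ⟨h.hb₁.1, h.hb₁.2.2.1⟩
  have hle := h.nmu.ncard_le_of_ncard_le (S := {z | (z ∈ M ∧ d ≤ z) ∨ a₁ ≤ z})
    (fun c hc u hu v hv huv huS => Or.imp
      (fun (hu' : u ∈ M ∧ d ≤ u) =>
        ⟨h.nmu.2.1.eq_of_mem hc hM hu hu'.1 ▸ hv, hu'.2.trans huv⟩) huv.trans' huS)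
    h.hA₁ h.hB₁ h.hB₂ h.symm.x_mem hbB₂ h.hb₁.2.2.2.1.le h.x_mem h.b₁_mem ?_
  · refine hle.not_gt (Set.ncard_lt_ncard ?_)
    have hlt : ∀ z ∈ B₁, (z ∈ M ∧ d ≤ z) ∨ a₁ ≤ z → b₁ < z := by
      intro z hzB hzS
      by_contra hnot
      have hzb : z ≤ b₁ := by
        rcases (h.nmu.1.1 B₁ h.hB₁).1.total hzB h.b₁_mem with hzb | hbz
        · exact hzb
        · exact (eq_of_le_of_not_lt hbz hnot).ge
      rcases hzS with ⟨hzM, hdz⟩ | haz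
      · rcases h.interval d hd z hdz (hzb.trans h.b₁_lt.le) with hz | hz
        · rcases hzb.lt_or_eq with hzb | rfl
          · exact h.notMem_of_le hz hzb hzB
          · exact hdB (h.nmu.2.1.eq_of_mem hM h.hB₂ hzM hbB₂ ▸ hdM)
        · exact h.notMem_of_mem hz hzB
      · exact h.incomp.1 (haz.trans hzb)
    exact ⟨fun z hz => ⟨hz.1, (hlt z hz.1 hz.2).le⟩,
      fun hsub => (hlt b₁ h.b₁_mem (hsub ⟨h.b₁_mem, le_rfl⟩).2).false⟩
  · have hT : {z | z ∈ A₁ ∧ x ≤ z} ⊆ insert x {z | z ∈ A₁ ∧ a₁ ≤ z} := by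
      rintro z ⟨hzA, hxz⟩
      rcases hxz.eq_or_lt with rfl | hxz
      · exact Set.mem_insert _ _
      refine Or.inr ⟨hzA, ?_⟩
      rcases (h.nmu.1.1 A₁ h.hA₁).1.total hzA (h.aA₁ ⟨h.ha₁.1, h.ha₁.2.2.1⟩) with hza | haz
      · exact (h.ha₁.2.2.2.1.eq_or_eq hxz.le hza |>.resolve_left hxz.ne').ge
      · exact haz
    have hda : d ∉ {z | z ∈ A₁ ∧ a₁ ≤ z} := fun hd' =>
      (hd'.2.trans_lt ((h.below d hd).trans h.ha₁.2.2.2.1.lt)).false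
    calc {z | z ∈ A₁ ∧ x ≤ z}.ncard ≤ (insert x {z | z ∈ A₁ ∧ a₁ ≤ z}).ncard :=
          Set.ncard_le_ncard hT
      _ ≤ {z | z ∈ A₁ ∧ a₁ ≤ z}.ncard + 1 := Set.ncard_insert_le _ _
      _ = (insert d {z | z ∈ A₁ ∧ a₁ ≤ z}).ncard := (Set.ncard_insert_of_notMem hda).symm
      _ ≤ (A₁ ∩ {z | (z ∈ M ∧ d ≤ z) ∨ a₁ ≤ z}).ncard :=
          Set.ncard_le_ncard <| Set.insert_subset ⟨hdA, Or.inl ⟨hdM, le_rfl⟩⟩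
            fun z hz => ⟨hz.1, Or.inr hz.2⟩

theorem subset_inter (h : DiamondAbove P C₁ C₂ a b D A₁ B₁ A₂ B₂ x y a₁ b₁) [Finite P]
    (hD : IsSatChain P D) : D ⊆ A₁ ∩ B₂ := by
  by_contra hnot
  obtain ⟨d, ⟨hd, hdbad⟩, hdmax⟩ :=
    (Set.toFinite (D \ (A₁ ∩ B₂))).exists_maximal (Set.sdiff_nonempty.2 hnot)
  obtain ⟨s, hsA, hsB, hds⟩ : ∃ s, s ∈ A₁ ∧ s ∈ B₂ ∧ d ⋖ s := by
    rcases Set.eq_empty_or_nonempty {w | w ∈ D ∧ d < w} with hemp | hne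
    · refine ⟨x, h.x_mem, h.symm.x_mem, ⟨h.below d hd, fun w hdw hwx => ?_⟩⟩
      have hw := h.interval d hd w hdw.le (hwx.trans h.diamond.lt).le
      rcases hw with hw | hw
      · exact ((h.diamond.2.2.2.2.1 w hw).1.trans_lt hwx).false
      · exact hemp.subset ⟨hw, hdw⟩
    · obtain ⟨s, ⟨hsD, hds⟩, hsmin⟩ := (Set.toFinite _).exists_minimal hne
      have hs : s ∈ A₁ ∩ B₂ := by
        by_contra hs
        exact (hds.trans_le (hdmax ⟨hsD, hs⟩ hds.le)).false
      exact ⟨s, hs.1, hs.2, hD.2 d hd s hsD hds fun z hz hdz =>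
        ((hsmin ⟨hz, hdz.1⟩ hdz.2.le).trans_lt hdz.2).false⟩
  obtain ⟨c, hc | hc, hdc, hsc⟩ := h.nmu.2.2.2.2 d s hds
  · have hdA : d ∈ A₁ := h.nmu.1.eq_of_mem hc h.hA₁ hsc hsA ▸ hdc
    exact hdbad ⟨hdA, h.mem_of_mem hd hdA⟩
  · have hdB : d ∈ B₂ := h.nmu.2.1.eq_of_mem hc h.hB₂ hsc hsB ▸ hdc
    exact hdbad ⟨h.symm.mem_of_mem hd hdB, hdB⟩

theorem ncard_lt (h : DiamondAbove P C₁ C₂ a b D A₁ B₁ A₂ B₂ x y a₁ b₁) [Finite P]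
    (hD : D ⊆ A₁ ∩ B₂) : D.ncard < (a \ {x, y}).ncard := by
  by_contra! hcard
  have hle := h.nmu.ncard_le_of_ncard_le
    (S := {z | (z ∈ B₂ ∧ (x ≤ z ∨ ∃ d ∈ D, d ≤ z)) ∨ (x < z ∧ ¬z ≤ y)})
    ?_ h.hA₁ h.hB₁ h.hB₂ h.symm.x_mem (h.bB₂ ⟨h.hb₁.1, h.hb₁.2.2.1⟩) h.hb₁.2.2.2.1.le
    h.x_mem h.b₁_mem ?_
  · refine hle.not_gt (Set.ncard_lt_ncard ⟨fun z ⟨hzB, hzS⟩ => ⟨hzB, ?_⟩, fun hsub => ?_⟩)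
    · refine ((h.nmu.1.1 B₁ h.hB₁).1.total hzB h.b₁_mem).elim (fun hzb => ?_) id
      by_contra hnot
      have hzb' : z < b₁ := lt_of_le_not_ge hzb hnot
      have hzy := hzb.trans h.b₁_lt.le
      rcases hzS with ⟨-, hxz | ⟨d, hd, hdz⟩⟩ | hz
      · exact h.notMem_of_le (h.diamond.2.2.2.2.2.out (Or.inl h.mem_inter.1.1)
          (Or.inl h.mem_inter.2.1) ⟨hxz, hzy⟩) hzb' hzB
      · rcases h.interval d hd z hdz hzy with hz | hz
        · exact h.notMem_of_le hz hzb' hzB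
        · exact h.notMem_of_mem hz hzB
      · exact hz.2 hzy
    · rcases (hsub ⟨h.y_mem, h.b₁_lt.le⟩).2 with hy | hy
      · exact h.symm.notMem hy.1 h.symm.y_mem
      · exact hy.2 le_rfl
  · intro c hc u hu v hv huv huS
    rcases huS with hu' | hu'
    · exact Or.inl ⟨h.nmu.2.1.eq_of_mem hc h.hB₂ hu hu'.1 ▸ hv,
        hu'.2.imp huv.trans' fun ⟨d, hd, hdu⟩ => ⟨d, hd, hdu.trans huv⟩⟩
    · exact Or.inr ⟨hu'.1.trans_le huv, fun hvy => hu'.2 (huv.trans hvy)⟩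
  · set T := {z | z ∈ A₁ ∧ x ≤ z} \ (a \ {x, y}) with hT
    have hdisj : Disjoint D T := Set.disjoint_left.2 fun d hd hdT =>
      (hdT.1.2.trans_lt (h.below d hd)).false
    have hTS : T ⊆ {z | (z ∈ B₂ ∧ (x ≤ z ∨ ∃ d ∈ D, d ≤ z)) ∨ (x < z ∧ ¬z ≤ y)} := by
      rintro z ⟨⟨hzA, hxz⟩, hza⟩
      rcases hxz.eq_or_lt with rfl | hlt
      · exact Or.inl ⟨h.symm.x_mem, Or.inl le_rfl⟩
      refine Or.inr ⟨hlt, fun hzy => ?_⟩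
      have hzy' : z ≠ y := fun hzy => h.notMem hzA (hzy ▸ h.y_mem)
      rcases h.diamond.2.2.2.2.2.out (Or.inl h.mem_inter.1.1)
          (Or.inl h.mem_inter.2.1) ⟨hxz, hzy⟩ with hz | hz
      · exact hza ⟨hz, by simp [hlt.ne', hzy']⟩
      · exact h.notMem hzA (h.bB₁ ⟨hz, hlt.ne'⟩)
    calc {z | z ∈ A₁ ∧ x ≤ z}.ncard ≤ ((a \ {x, y}) ∪ T).ncard :=
          Set.ncard_le_ncard (by rw [hT, Set.union_sdiff_self]; exact Set.subset_union_right)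
      _ ≤ (a \ {x, y}).ncard + T.ncard := Set.ncard_union_le _ _
      _ ≤ D.ncard + T.ncard := Nat.add_le_add_right hcard _
      _ = (D ∪ T).ncard := (Set.ncard_union_eq hdisj).symm
      _ ≤ (A₁ ∩ {z | (z ∈ B₂ ∧ (x ≤ z ∨ ∃ d ∈ D, d ≤ z)) ∨ (x < z ∧ ¬z ≤ y)}).ncard :=
        Set.ncard_le_ncard <| Set.union_subset
          (fun d hd => ⟨(hD hd).1, Or.inl ⟨(hD hd).2, Or.inr ⟨d, hd, le_rfl⟩⟩⟩)
          fun z hz => ⟨hz.1.1, hTS hz⟩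

end DiamondAbove

/-- The half of the main theorem that concerns the chain below a Type I diamond. -/
theorem TypeI.bottom_chain {P : Type*} [PartialOrder P] [Finite P] {C₁ C₂ : Set (Set P)}
    (h : NMUvia P C₁ C₂) {a b D : Set P} {x y : P} (hd : IsDiamond P a b x y)
    (hI : TypeI P C₁ C₂ a b x y) (hD : IsSatChain P D) (hbelow : ∀ d ∈ D, d < x)
    (hint : ∀ d ∈ D, ∀ z, d ≤ z → z ≤ y → z ∈ a ∪ b ∪ D)
    (hnorel : ∀ p ∈ a \ {x, y}, ∀ q ∈ b \ {x, y}, ¬p ≤ q ∧ ¬q ≤ p) :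
    (∃ c ∈ C₁, (D ∪ a) \ {y} ⊆ c) ∧ (∃ c ∈ C₂, (D ∪ b) \ {y} ⊆ c) ∧
      D.ncard < min (a.ncard - 2) (b.ncard - 2) := by
  obtain ⟨⟨A₁, hA₁, haA₁⟩, ⟨B₂, hB₂, hbB₂⟩, ⟨B₁, hB₁, hbB₁⟩, ⟨A₂, hA₂, haA₂⟩⟩ := hI
  obtain ⟨a₁, ha₁⟩ := hd.exists_atom
  obtain ⟨b₁, hb₁⟩ := hd.symm.exists_atom
  have hconf : DiamondAbove P C₁ C₂ a b D A₁ B₁ A₂ B₂ x y a₁ b₁ :=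
    ⟨h, hd, hA₁, hB₁, hA₂, hB₂, haA₁, hbB₁, haA₂, hbB₂, ha₁, hb₁,
      hnorel a₁ ⟨ha₁.1, by simp [ha₁.2.1, ha₁.2.2.1]⟩ b₁ ⟨hb₁.1, by simp [hb₁.2.1, hb₁.2.2.1]⟩,
      hbelow, hint⟩
  have hsub := hconf.subset_inter hD
  have hcard : ∀ s : Set P, x ∈ s → y ∈ s → (s \ {x, y}).ncard = s.ncard - 2 :=
    fun s hx hy => by
      rw [Set.ncard_sdiff (Set.pair_subset hx hy), Set.ncard_pair hd.lt.ne]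
  obtain ⟨⟨hxa, hxb⟩, hya, hyb⟩ := hconf.mem_inter
  refine ⟨⟨A₁, hA₁, ?_⟩, ⟨B₂, hB₂, ?_⟩, lt_min ?_ ?_⟩
  · rintro z ⟨hz | hz, hzy⟩
    exacts [(hsub hz).1, haA₁ ⟨hz, hzy⟩]
  · rintro z ⟨hz | hz, hzy⟩
    exacts [(hsub hz).2, hbB₂ ⟨hz, hzy⟩]
  · exact hcard a hxa hya ▸ hconf.ncard_lt hsub
  · exact hcard b hxb hyb ▸ hconf.symm.ncard_lt (hsub.trans_eq (Set.inter_comm _ _))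

/-- If a diamond `Q` (chains `a`, `b`, minimum `x`, maximum `y`) with bottom chain `Cc`
(whose maximum `m` is covered by `x`) and top chain `Dd` (whose minimum `e` covers `y`)
sits convexly in a non-messing-up poset with no other elements or relations, and `Q` has
Type I, then (up to swapping the covers) the bottom chain continues the appropriate
diamond chains and the top chain continues the other ones, and moreover
`max {|Cc|, |Dd|} < min {|a| − 2, |b| − 2}`. -/
theorem typeI_diamond_chain_bounds {P : Type*} [PartialOrder P] [Finite P]
    (C₁ C₂ : Set (Set P)) (h : NMUvia P C₁ C₂)
    (a b : Set P) (x y : P) (hdiam : IsDiamond P a b x y)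
    (Cc Dd : Set P) (hCc : IsSatChain P Cc) (hDd : IsSatChain P Dd)
    (m : P) (hm : m ∈ Cc) (hmtop : ∀ u ∈ Cc, u ≤ m) (hmx : m ⋖ x)
    (e : P) (he : e ∈ Dd) (hebot : ∀ u ∈ Dd, e ≤ u) (hye : y ⋖ e)
    (hconv : (a ∪ b ∪ Cc ∪ Dd).OrdConnected)
    (hdisjC : Disjoint Cc (a ∪ b ∪ Dd)) (hdisjD : Disjoint Dd (a ∪ b))
    (hnorel : ∀ p ∈ a \ {x, y}, ∀ q ∈ b \ {x, y}, ¬p ≤ q ∧ ¬q ≤ p)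
    (hI : TypeI P C₁ C₂ a b x y ∨ TypeI P C₂ C₁ a b x y) :
    (((∃ c ∈ C₁, (Cc ∪ a) \ {y} ⊆ c) ∧ (∃ c ∈ C₂, (Cc ∪ b) \ {y} ⊆ c) ∧
      (∃ c ∈ C₂, (a ∪ Dd) \ {x} ⊆ c) ∧ (∃ c ∈ C₁, (b ∪ Dd) \ {x} ⊆ c)) ∨
     ((∃ c ∈ C₂, (Cc ∪ a) \ {y} ⊆ c) ∧ (∃ c ∈ C₁, (Cc ∪ b) \ {y} ⊆ c) ∧
      (∃ c ∈ C₁, (a ∪ Dd) \ {x} ⊆ c) ∧ (∃ c ∈ C₂, (b ∪ Dd) \ {x} ⊆ c))) ∧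
    max Cc.ncard Dd.ncard < min (a.ncard - 2) (b.ncard - 2) := by
  have hx : x ∈ a ∩ b := hdiam.2.2.2.1 ▸ Set.mem_insert x {y}
  have hy : y ∈ a ∩ b := hdiam.2.2.2.1 ▸ Set.mem_insert_of_mem x rfl
  have hbelow : ∀ d ∈ Cc, d < x := fun d hd => (hmtop d hd).trans_lt hmx.lt
  have habove : ∀ d ∈ Dd, y < d := fun d hd => hye.lt.trans_le (hebot d hd)
  have hintC : ∀ d ∈ Cc, ∀ z, d ≤ z → z ≤ y → z ∈ a ∪ b ∪ Cc := fun d hd z hdz hzy =>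
    (hconv.out (Or.inl (Or.inr hd)) (Or.inl (Or.inl (Or.inl hy.1))) ⟨hdz, hzy⟩).resolve_right
      fun hz => ((habove z hz).trans_le hzy).false
  have hintD : ∀ d ∈ Dd, ∀ z, z ≤ d → x ≤ z → z ∈ a ∪ b ∪ Dd := fun d hd z hzd hxz => by
    rcases hconv.out (Or.inl (Or.inl (Or.inl hx.1))) (Or.inr hd) ⟨hxz, hzd⟩ with
      (hz | hz) | hz
    · exact Or.inl hz
    · exact ((hbelow z hz).trans_le hxz).false.elim
    · exact Or.inr hz
  have hnorel' : ∀ p ∈ b \ {y, x}, ∀ q ∈ a \ {y, x}, ¬q ≤ p ∧ ¬p ≤ q := fun p hp q hq =>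
    hnorel q (Set.pair_comm x y ▸ hq) p (Set.pair_comm x y ▸ hp)
  have key : ∀ K₁ K₂ : Set (Set P), NMUvia P K₁ K₂ → TypeI P K₁ K₂ a b x y →
      ((∃ c ∈ K₁, (Cc ∪ a) \ {y} ⊆ c) ∧ (∃ c ∈ K₂, (Cc ∪ b) \ {y} ⊆ c) ∧
        (∃ c ∈ K₂, (a ∪ Dd) \ {x} ⊆ c) ∧ (∃ c ∈ K₁, (b ∪ Dd) \ {x} ⊆ c)) ∧
      max Cc.ncard Dd.ncard < min (a.ncard - 2) (b.ncard - 2) := fun K₁ K₂ hK hT => by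
    obtain ⟨hC₁, hC₂, hC⟩ := hT.bottom_chain hK hdiam hCc hbelow hintC hnorel
    obtain ⟨hD₁, hD₂, hD⟩ := TypeI.bottom_chain (P := Pᵒᵈ) (D := Dd) hK.dual hdiam.dual.symm
      hT.dual hDd.dual habove (Set.union_comm a b ▸ hintD) hnorel'
    rw [Set.union_comm a Dd, Set.union_comm b Dd]
    exact ⟨⟨hC₁, hC₂, hD₂, hD₁⟩, max_lt hC (min_comm (a.ncard - 2) (b.ncard - 2) ▸ hD)⟩
  rcases hI with hI | hI
  · exact ⟨Or.inl (key C₁ C₂ h hI).1, (key C₁ C₂ h hI).2⟩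
  · exact ⟨Or.inr (key C₂ C₁ h.symm hI).1, (key C₂ C₁ h.symm hI).2⟩
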